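/- Let p > 5, k algebraically closed of characteristic p, G̃ = GL₂(F_{p²}). Let M ⊂ U_{(p-1)²} be the G̃-submodule generated by the homogeneous monomials of degree (p-1)² (in k[X,Y]/(X^{p²}-X, Y^{p²}-Y)). Then M has dimension (p-1)² + 1, contains the image of V_{1,p-2} := Sym¹(k²) ⊗ (Sym^{p-2}(k²))^τ (of dimension 2(p-1)) under the embedding Ψ(f⊗g) = f(X,Y)g(X^p,Y^p), and the quotient M/Ψ(V_{1,p-2}) is isomorphic to Sym^{p-3}(k²) ⊗ det² ⊗ (Sym^{p-3}(k²))^τ as a G̃-module; note the dimension identity (p-1)² + 1 = (p-2)² + 2(p-1). -/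

import Mathlib

open scoped TensorProduct

namespace MvPolynomial

theorem homogeneousSubmodule_fin_two_eq_span (R : Type*) [CommSemiring R] (n : ℕ) :
    homogeneousSubmodule (Fin 2) R n =
      Submodule.span R {f | ∃ a b : ℕ, a + b = n ∧ f = X 0 ^ a * X 1 ^ b} := by
  apply le_antisymm
  · intro f hf
    rw [f.as_sum]
    refine Submodule.sum_mem _ fun m hm => ?_
    have hdeg : m 0 + m 1 = n := by
      have := hf (mem_support_iff.mp hm)
      simpa [Finsupp.weight_apply, Finsupp.sum_fintype] using this
    have : monomial m (coeff m f) =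
        coeff m f • (X 0 ^ m 0 * X 1 ^ m 1 : MvPolynomial (Fin 2) R) := by
      rw [monomial_eq, Finsupp.prod_fintype _ _ (by simp), Fin.prod_univ_two, smul_eq_C_mul]
    rw [this]
    exact Submodule.smul_mem _ _ (Submodule.subset_span ⟨_, _, hdeg, rfl⟩)
  · rw [Submodule.span_le]
    rintro _ ⟨a, b, rfl, rfl⟩
    exact (isHomogeneous_X_pow 0 a).mul (isHomogeneous_X_pow 1 b)

theorem finrank_homogeneousSubmodule_fin_two_le (K : Type*) [Field K] (n : ℕ) :
    Module.finrank K (homogeneousSubmodule (Fin 2) K n) ≤ n + 1 := by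
  have : homogeneousSubmodule (Fin 2) K n =
      Submodule.span K (Set.range fun i : Fin (n + 1) => X 0 ^ (i : ℕ) * X 1 ^ (n - i)) := by
    rw [homogeneousSubmodule_fin_two_eq_span]
    congr 1
    ext f
    constructor
    · rintro ⟨a, b, rfl, rfl⟩
      exact ⟨⟨a, by omega⟩, by simp⟩
    · rintro ⟨i, rfl⟩
      exact ⟨i, n - i, by omega, rfl⟩
  rw [this]
  exact (finrank_range_le_card _).trans (by simp)

/-- The linear map `X₀ᵃ X₁ᵇ ↦ X₀ᵃ⁺² X₁ᵇ⁺² / ((a + 2)(a + 1))`: where the denominators are nonzero,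
the image `F` of `f` satisfies `∂²F/∂X₀² = X₁² f`. -/
noncomputable def hessianLift (K : Type*) [Field K] :
    MvPolynomial (Fin 2) K →ₗ[K] MvPolynomial (Fin 2) K :=
  (basisMonomials (Fin 2) K).constr K fun m =>
    (((m 0 : K) + 2) * ((m 0 : K) + 1))⁻¹ • (X 0 ^ (m 0 + 2) * X 1 ^ (m 1 + 2))

theorem hessianLift_X_pow_mul_X_pow {K : Type*} [Field K] (a b : ℕ) :
    hessianLift K (X 0 ^ a * X 1 ^ b) =
      (((a : K) + 2) * ((a : K) + 1))⁻¹ • (X 0 ^ (a + 2) * X 1 ^ (b + 2)) := by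
  have : (X 0 ^ a * X 1 ^ b : MvPolynomial (Fin 2) K) =
      basisMonomials (Fin 2) K (Finsupp.single 0 a + Finsupp.single 1 b) := by
    simp [X_pow_eq_monomial, monomial_mul]
  rw [this, hessianLift, Module.Basis.constr_basis]
  simp

theorem pderiv_zero_X_pow_mul_X_pow {R : Type*} [CommSemiring R] (a b : ℕ) :
    pderiv 0 (X 0 ^ (a + 1) * X 1 ^ b : MvPolynomial (Fin 2) R) =
      ((a : R) + 1) • (X 0 ^ a * X 1 ^ b) := by
  simp [pderiv_X, smul_eq_C_mul]
  ring

theorem pderiv_one_X_pow_mul_X_pow {R : Type*} [CommSemiring R] (a b : ℕ) :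
    pderiv 1 (X 0 ^ a * X 1 ^ (b + 1) : MvPolynomial (Fin 2) R) =
      ((b : R) + 1) • (X 0 ^ a * X 1 ^ b) := by
  simp [pderiv_X, smul_eq_C_mul]
  ring

section CharP

variable {K : Type*} [Field K] {p : ℕ} [CharP K p]

theorem isHomogeneous_hessianLift {n : ℕ} {f : MvPolynomial (Fin 2) K} (hf : f.IsHomogeneous n) :
    (hessianLift K f).IsHomogeneous (n + 4) := by
  have : f ∈ homogeneousSubmodule (Fin 2) K n := hf
  rw [homogeneousSubmodule_fin_two_eq_span] at this
  rw [← mem_homogeneousSubmodule]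
  clear hf
  induction this using Submodule.span_induction with
  | mem _ h =>
    obtain ⟨a, b, rfl, rfl⟩ := h
    rw [hessianLift_X_pow_mul_X_pow]
    refine Submodule.smul_mem _ _ ?_
    have := (isHomogeneous_X_pow (R := K) (0 : Fin 2) (a + 2)).mul
      (isHomogeneous_X_pow (1 : Fin 2) (b + 2))
    rw [mem_homogeneousSubmodule]
    convert this using 1
    ring
  | zero => simp
  | add x y _ _ hx hy => rw [map_add]; exact Submodule.add_mem _ hx hy
  | smul c x _ hx => rw [map_smul]; exact Submodule.smul_mem _ _ hx

theorem cast_ne_zero_of_lt [Fact p.Prime] {a : ℕ} (h0 : 0 < a) (h : a < p) : (a : K) ≠ 0 := by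
  rw [Ne, CharP.cast_eq_zero_iff K p]
  exact Nat.not_dvd_of_pos_of_lt h0 h

theorem pderiv_pderiv_hessianLift [Fact p.Prime] {n : ℕ} (hn : n + 3 = p)
    {f : MvPolynomial (Fin 2) K} (hf : f.IsHomogeneous n) :
    pderiv 0 (pderiv 0 (hessianLift K f)) = X 1 ^ 2 * f ∧
      pderiv 1 (pderiv 0 (hessianLift K f)) = -(X 0 * X 1 * f) ∧
      pderiv 0 (pderiv 1 (hessianLift K f)) = -(X 0 * X 1 * f) ∧
      pderiv 1 (pderiv 1 (hessianLift K f)) = X 0 ^ 2 * f := by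
  have : f ∈ homogeneousSubmodule (Fin 2) K n := hf
  rw [homogeneousSubmodule_fin_two_eq_span] at this
  clear hf
  induction this using Submodule.span_induction with
  | mem _ h =>
    obtain ⟨a, b, rfl, rfl⟩ := h
    have h1 : (a : K) + 1 ≠ 0 := by
      exact_mod_cast cast_ne_zero_of_lt (K := K) (p := p) (a := a + 1) (by omega) (by omega)
    have h2 : (a : K) + 2 ≠ 0 := by
      exact_mod_cast cast_ne_zero_of_lt (K := K) (p := p) (a := a + 2) (by omega) (by omega)
    have hs : (a : K) + b + 3 = 0 := by
      have := CharP.cast_eq_zero K p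
      rw [← hn] at this
      exact_mod_cast this
    have hb : (b : K) = -a - 3 := by linear_combination hs
    have h12 : (a : K) + 1 + 1 ≠ 0 := by rwa [add_assoc, one_add_one_eq_two]
    have e0 : (X 1 ^ 2 * (X 0 ^ a * X 1 ^ b) : MvPolynomial (Fin 2) K) =
      X 0 ^ a * X 1 ^ (b + 2) := by ring
    have e1 : (X 0 * X 1 * (X 0 ^ a * X 1 ^ b) : MvPolynomial (Fin 2) K) =
      X 0 ^ (a + 1) * X 1 ^ (b + 1) := by ring
    have e2 : (X 0 ^ 2 * (X 0 ^ a * X 1 ^ b) : MvPolynomial (Fin 2) K) =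
      X 0 ^ (a + 2) * X 1 ^ b := by ring
    rw [hessianLift_X_pow_mul_X_pow, e0, e1, e2]
    simp only [Derivation.map_smul, pderiv_zero_X_pow_mul_X_pow, pderiv_one_X_pow_mul_X_pow,
      smul_smul, Nat.cast_add, Nat.cast_one, hb]
    refine ⟨?_, ?_, ?_, ?_⟩
    · convert one_smul K _ using 2
      field_simp
      ring
    · convert neg_one_smul K _ using 2
      field_simp
      ring
    · convert neg_one_smul K _ using 2
      field_simp
      ring
    · convert one_smul K _ using 2
      field_simp
      ring
  | zero => simp
  | add x y _ _ hx hy =>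
    simp only [map_add, hx, hy]
    refine ⟨?_, ?_, ?_, ?_⟩ <;> ring
  | smul c x _ hx =>
    simp only [map_smul, Derivation.map_smul, hx, smul_neg, mul_smul_comm, and_self]

theorem pderiv_bind₁ {R σ τ : Type*} [CommSemiring R] [Fintype σ] (φ : σ → MvPolynomial τ R)
    (t : τ) (f : MvPolynomial σ R) :
    pderiv t (bind₁ φ f) = ∑ i, bind₁ φ (pderiv i f) * pderiv t (φ i) := by
  classical
  induction f using MvPolynomial.induction_on with
  | C a => simp
  | add f g hf hg => simp [hf, hg, add_mul, Finset.sum_add_distrib]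
  | mul_X f j hf =>
    have h (i : σ) : bind₁ φ (if j = i then f else 0) = if j = i then bind₁ φ f else 0 := by
      split_ifs <;> simp
    simp [hf, pderiv_X, add_mul, Finset.sum_add_distrib, Pi.single_apply, Finset.mul_sum, h,
      mul_assoc]

theorem pderiv_pderiv_bind₁_hessianLift [Fact p.Prime] {n : ℕ} (hn : n + 3 = p)
    {f : MvPolynomial (Fin 2) K} (hf : f.IsHomogeneous n) (g : Matrix (Fin 2) (Fin 2) K) :
    pderiv 0 (pderiv 0 (bind₁ (fun i => ∑ j, C (g j i) * X j) (hessianLift K f))) =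
      X 1 ^ 2 * (g.det ^ 2 • bind₁ (fun i => ∑ j, C (g j i) * X j) f) := by
  obtain ⟨h00, h10, h01, h11⟩ := pderiv_pderiv_hessianLift hn hf
  have hX : ∀ i, pderiv 0 (∑ j, C (g j i) * X j) = C (g 0 i) := by
    intro i
    simp [Fin.sum_univ_two, pderiv_X]
  have hX0 : pderiv 0 (X 0 : MvPolynomial (Fin 2) K) = 1 := pderiv_X_self 0
  have hX1 : pderiv 0 (X 1 : MvPolynomial (Fin 2) K) = 0 := pderiv_X_of_ne one_ne_zero
  simp only [pderiv_bind₁, hX]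
  simp only [Fin.sum_univ_two, map_add, pderiv_mul, pderiv_bind₁, pderiv_C, h00, h10, h01, h11,
    hX0, hX1, mul_zero, add_zero, map_mul, map_neg, map_pow, bind₁_X_right, smul_eq_C_mul,
    Matrix.det_fin_two, map_sub]
  ring

theorem exists_sub_hessianLift_mem_span [Fact p.Prime] {n : ℕ} (hn : n + 3 = p)
    {u : MvPolynomial (Fin 2) K} (hu : u.IsHomogeneous (n + 4)) :
    ∃ q : MvPolynomial (Fin 2) K, q.IsHomogeneous n ∧ u - hessianLift K q ∈
      Submodule.span K {f | ∃ i j : Fin 2, f = X i * X j ^ p} := by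
  have : u ∈ homogeneousSubmodule (Fin 2) K (n + 4) := hu
  rw [homogeneousSubmodule_fin_two_eq_span] at this
  clear hu
  induction this using Submodule.span_induction with
  | mem _ h =>
    obtain ⟨a, b, hab, rfl⟩ := h
    by_cases ha : 2 ≤ a ∧ 2 ≤ b
    · obtain ⟨a, rfl⟩ := Nat.exists_eq_add_of_le' ha.1
      obtain ⟨b, rfl⟩ := Nat.exists_eq_add_of_le' ha.2
      have h1 : (a : K) + 1 ≠ 0 := by
        exact_mod_cast cast_ne_zero_of_lt (K := K) (p := p) (a := a + 1) (by omega) (by omega)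
      have h2 : (a : K) + 2 ≠ 0 := by
        exact_mod_cast cast_ne_zero_of_lt (K := K) (p := p) (a := a + 2) (by omega) (by omega)
      refine ⟨(((a : K) + 2) * ((a : K) + 1)) • (X 0 ^ a * X 1 ^ b),
        Submodule.smul_mem (homogeneousSubmodule (Fin 2) K n) _ ?_, ?_⟩
      · rw [mem_homogeneousSubmodule]
        convert (isHomogeneous_X_pow (R := K) (0 : Fin 2) a).mul
          (isHomogeneous_X_pow (1 : Fin 2) b) using 1
        omega
      · rw [map_smul, hessianLift_X_pow_mul_X_pow, smul_smul, mul_inv_cancel₀ (mul_ne_zero h2 h1),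
          one_smul, sub_self]
        exact Submodule.zero_mem _
    · refine ⟨0, isHomogeneous_zero _ _ _, ?_⟩
      rw [map_zero, sub_zero]
      apply Submodule.subset_span
      have : (a = 0 ∧ b = p + 1) ∨ (a = 1 ∧ b = p) ∨ (a = p + 1 ∧ b = 0) ∨ (a = p ∧ b = 1) := by
        omega
      obtain ⟨rfl, rfl⟩ | ⟨rfl, rfl⟩ | ⟨rfl, rfl⟩ | ⟨rfl, rfl⟩ := this
      · exact ⟨1, 1, by ring⟩
      · exact ⟨0, 1, by ring⟩
      · exact ⟨0, 0, by ring⟩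
      · exact ⟨1, 0, by ring⟩
  | zero => exact ⟨0, isHomogeneous_zero _ _ _, by simp⟩
  | add x y _ _ hx hy =>
    obtain ⟨q, hq, hxq⟩ := hx
    obtain ⟨r, hr, hyr⟩ := hy
    refine ⟨q + r, hq.add hr, ?_⟩
    rw [map_add, add_sub_add_comm]
    exact Submodule.add_mem _ hxq hyr
  | smul c x _ hx =>
    obtain ⟨q, hq, hxq⟩ := hx
    refine ⟨c • q, Submodule.smul_mem (homogeneousSubmodule (Fin 2) K n) c hq, ?_⟩
    rw [map_smul, ← smul_sub]
    exact Submodule.smul_mem _ _ hxq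

theorem mem_span_of_pderiv_pderiv_eq_zero [Fact p.Prime] {n : ℕ} (hn : n + 3 = p)
    {u : MvPolynomial (Fin 2) K} (hu : u.IsHomogeneous (n + 4))
    (h : pderiv 0 (pderiv 0 u) = 0) :
    u ∈ Submodule.span K {f | ∃ i j : Fin 2, f = X i * X j ^ p} := by
  obtain ⟨q, hq, huq⟩ := exists_sub_hessianLift_mem_span hn hu
  have hker : Submodule.span K {f : MvPolynomial (Fin 2) K | ∃ i j : Fin 2, f = X i * X j ^ p} ≤
      LinearMap.ker ((pderiv (R := K) (0 : Fin 2)).toLinearMap ∘ₗ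
        (pderiv (R := K) (0 : Fin 2)).toLinearMap) := by
    rw [Submodule.span_le]
    rintro _ ⟨i, j, rfl⟩
    have hp : (p : MvPolynomial (Fin 2) K) = 0 := CharP.cast_eq_zero _ p
    fin_cases i <;> simp
  have := hker huq
  rw [LinearMap.mem_ker] at this
  simp only [LinearMap.comp_apply, Derivation.coeFn_coe, map_sub, h,
    (pderiv_pderiv_hessianLift hn hq).1] at this
  have hq0 : q = 0 := by simpa [X_ne_zero] using this
  simpa [hq0] using huq

end CharP

section PolynomialFunctions

variable {K : Type*} [Field K] {p : ℕ}

theorem X_pow_mul_X_pow_mem_homogeneousSubmodule {R : Type*} [CommSemiring R] {a b n : ℕ}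
    (h : a + b = n) :
    (X 0 ^ a * X 1 ^ b : MvPolynomial (Fin 2) R) ∈ homogeneousSubmodule (Fin 2) R n := by
  subst h
  exact (isHomogeneous_X_pow 0 a).mul (isHomogeneous_X_pow 1 b)

theorem IsHomogeneous.expand {R σ : Type*} [CommSemiring R] {n : ℕ} {f : MvPolynomial σ R}
    (hf : f.IsHomogeneous n) (p : ℕ) : (MvPolynomial.expand p f).IsHomogeneous (p * n) :=
  hf.aeval _ fun i => isHomogeneous_X_pow i p

theorem isHomogeneous_sum_C_mul_X {R σ : Type*} [CommSemiring R] [Fintype σ] (c : σ → R) :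
    (∑ j, C (c j) * X j).IsHomogeneous 1 :=
  IsHomogeneous.sum _ _ _ fun j _ => isHomogeneous_C_mul_X (c j) j

theorem IsHomogeneous.bind₁_linear {R σ : Type*} [CommSemiring R] [Fintype σ] {n : ℕ}
    {f : MvPolynomial σ R} (hf : f.IsHomogeneous n) (c : Matrix σ σ R) :
    (bind₁ (fun i => ∑ j, C (c j i) * X j) f).IsHomogeneous n := by
  simpa using hf.aeval _ fun i => isHomogeneous_sum_C_mul_X fun j => c j i

theorem bind₁_linear_expand {R σ : Type*} [CommSemiring R] [Fintype σ] (p : ℕ) [ExpChar R p]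
    (c : Matrix σ σ R) (f : MvPolynomial σ R) :
    bind₁ (fun i => ∑ j, C (c j i) * X j) (expand p f) =
      expand p (bind₁ (fun i => ∑ j, C (c j i ^ p) * X j) f) := by
  have : (bind₁ fun i => ∑ j, C (c j i) * X j).comp (expand p) =
      (expand p).comp (bind₁ fun i => ∑ j, C (c j i ^ p) * X j) := by
    ext1 i
    simp [sum_pow_char p, mul_pow]
  exact DFunLike.congr_fun this f

/-- The polynomial function on `F²` attached to a polynomial with coefficients in an
extension `K` of `F`. -/
noncomputable def toFunOn {F : Type*} [Field F] (ι : F →+* K) :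
    MvPolynomial (Fin 2) K →ₐ[K] ((Fin 2 → F) → K) :=
  aeval fun i v => ι (v i)

variable {F : Type*} [Field F] (ι : F →+* K)

theorem toFunOn_apply (f : MvPolynomial (Fin 2) K) (v : Fin 2 → F) :
    toFunOn ι f v = eval (fun i => ι (v i)) f := by
  have : (Pi.evalAlgHom K (fun _ : Fin 2 → F => K) v).comp (toFunOn ι) =
      aeval fun i => ι (v i) := by
    ext1 i
    simp [toFunOn]
  exact DFunLike.congr_fun this f

theorem toFunOn_expand_apply (f : MvPolynomial (Fin 2) K) (v : Fin 2 → F) (p : ℕ) :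
    toFunOn ι (expand p f) v = eval (fun i => ι (v i) ^ p) f := by
  rw [toFunOn_apply, eval, coe_eval₂Hom, eval₂_expand]
  rfl

theorem toFunOn_bind₁_apply (g : Matrix (Fin 2) (Fin 2) F) (f : MvPolynomial (Fin 2) K)
    (v : Fin 2 → F) :
    toFunOn ι (bind₁ (fun i => ∑ j, C (ι (g j i)) * X j) f) v =
      toFunOn ι f (Matrix.vecMul v g) := by
  rw [toFunOn_apply, toFunOn_apply, ← coe_aeval_eq_eval, RingHom.coe_coe, aeval_bind₁,
    ← coe_aeval_eq_eval, RingHom.coe_coe]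
  congr 2
  ext i
  simp [Matrix.vecMul, dotProduct, mul_comm]

theorem linearIndependent_toFunOn [Fintype F] {d : ℕ} (hd : d < Fintype.card F) :
    LinearIndependent K fun i : Fin (d + 1) =>
      toFunOn ι (X 0 ^ (i : ℕ) * X 1 ^ (d - i)) := by
  rw [Fintype.linearIndependent_iff]
  intro c hc
  set P : Polynomial K := ∑ i : Fin (d + 1), Polynomial.monomial i (c i) with hP
  have hP0 : P = 0 := by
    refine Polynomial.eq_zero_of_natDegree_lt_card_of_eval_eq_zero P ι.injective (fun x => ?_) ?_
    · have := congrFun hc ![x, 1]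
      simpa [toFunOn_apply, hP, Polynomial.eval_finsetSum] using this
    · refine lt_of_le_of_lt (Polynomial.natDegree_sum_le_of_forall_le _ _ fun i _ => ?_) hd
      exact (Polynomial.natDegree_monomial_le _).trans (by omega)
  intro i
  have := congrArg (Polynomial.coeff · (i : ℕ)) hP0
  simpa [hP, Polynomial.finsetSum_coeff, Polynomial.coeff_monomial, Fin.val_inj] using this

/-- The polynomials `∑ f * g(X₀ᵖ, X₁ᵖ)` with `f` of degree `a` and `g` of degree `b`. -/
noncomputable def twistedProduct (K : Type*) [Field K] (p a b : ℕ) :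
    Submodule K (MvPolynomial (Fin 2) K) :=
  homogeneousSubmodule (Fin 2) K a *
    (homogeneousSubmodule (Fin 2) K b).map (expand p).toLinearMap

theorem mul_expand_mem_twistedProduct {a b : ℕ} {f g : MvPolynomial (Fin 2) K}
    (hf : f.IsHomogeneous a) (hg : g.IsHomogeneous b) :
    f * expand p g ∈ twistedProduct K p a b :=
  Submodule.mul_mem_mul hf ⟨g, hg, rfl⟩

theorem twistedProduct_le (p a b : ℕ) :
    twistedProduct K p a b ≤ homogeneousSubmodule (Fin 2) K (a + p * b) := by
  rw [twistedProduct, Submodule.mul_le]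
  rintro f hf _ ⟨g, hg, rfl⟩
  exact IsHomogeneous.mul hf (IsHomogeneous.expand hg p)

theorem bind₁_linear_mem_twistedProduct [Fact p.Prime] [CharP K p] {a b : ℕ}
    {f : MvPolynomial (Fin 2) K} (hf : f ∈ twistedProduct K p a b) (c : Matrix (Fin 2) (Fin 2) K) :
    bind₁ (fun i => ∑ j, C (c j i) * X j) f ∈ twistedProduct K p a b := by
  have : ExpChar K p := .prime Fact.out
  rw [twistedProduct] at hf
  induction hf using Submodule.mul_induction_on' with
  | mem_mul_mem f hf g hg =>
    obtain ⟨g, hg, rfl⟩ := hg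
    rw [map_mul, AlgHom.toLinearMap_apply, bind₁_linear_expand]
    exact mul_expand_mem_twistedProduct (IsHomogeneous.bind₁_linear hf c)
      (IsHomogeneous.bind₁_linear hg (c.map (· ^ p)))
  | add x _ y _ hx hy =>
    rw [map_add]
    exact Submodule.add_mem _ hx hy

theorem twistedProduct_one_eq_span (p b : ℕ) :
    twistedProduct K p 1 b = Submodule.span K (Set.range fun x : Fin 2 × Fin (b + 1) =>
      X 0 ^ ((x.1 : ℕ) + p * x.2) * X 1 ^ (1 + p * b - ((x.1 : ℕ) + p * x.2))) := by
  rw [twistedProduct, homogeneousSubmodule_fin_two_eq_span, homogeneousSubmodule_fin_two_eq_span,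
    Submodule.map_span, Submodule.span_mul_span]
  have key : ∀ i j c d : ℕ, i + j = 1 → c + d = b →
      (X 0 ^ i * X 1 ^ j * (expand p).toLinearMap (X 0 ^ c * X 1 ^ d) : MvPolynomial (Fin 2) K) =
        X 0 ^ (i + p * c) * X 1 ^ (1 + p * b - (i + p * c)) := by
    rintro i j c d hij rfl
    have : 1 + p * (c + d) - (i + p * c) = j + p * d := by
      rw [mul_add]; omega
    rw [this]
    simp only [AlgHom.toLinearMap_apply, map_mul, map_pow, expand_X]
    ring
  congr 1
  ext f
  constructor
  · rintro ⟨_, ⟨i, j, hij, rfl⟩, _, ⟨_, ⟨c, d, hcd, rfl⟩, rfl⟩, rfl⟩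
    exact ⟨(⟨i, by omega⟩, ⟨c, by omega⟩), (key i j c d hij hcd).symm⟩
  · rintro ⟨⟨i, c⟩, rfl⟩
    exact ⟨_, ⟨i, 1 - i, by omega, rfl⟩, _, ⟨_, ⟨c, b - c, by omega, rfl⟩, rfl⟩,
      key i (1 - i) c (b - c) (by omega) (by omega)⟩

theorem mul_expand_mem_twistedProduct_of_mem_span {n : ℕ} {u h : MvPolynomial (Fin 2) K}
    (hu : u ∈ Submodule.span K {f | ∃ i j : Fin 2, f = X i * X j ^ p}) (hh : h.IsHomogeneous n) :
    u * expand p h ∈ twistedProduct K p 1 (n + 1) := by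
  induction hu using Submodule.span_induction with
  | mem _ hx =>
    obtain ⟨i, j, rfl⟩ := hx
    have := mul_expand_mem_twistedProduct (p := p) (isHomogeneous_X K i)
      ((isHomogeneous_X K j).mul hh)
    rw [map_mul, expand_X, ← mul_assoc, add_comm 1 n] at this
    exact this
  | zero => simp
  | add x y _ _ hx hy =>
    rw [add_mul]
    exact Submodule.add_mem _ hx hy
  | smul c x _ hx =>
    rw [smul_mul_assoc]
    exact Submodule.smul_mem _ _ hx

theorem homogeneousSubmodule_le_sup [Fact p.Prime] [CharP K p] {n : ℕ} (hn : n + 3 = p) :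
    homogeneousSubmodule (Fin 2) K (1 + p * (n + 1)) ≤ twistedProduct K p 1 (n + 1) ⊔
      (homogeneousSubmodule (Fin 2) K n).map (hessianLift K) *
        (homogeneousSubmodule (Fin 2) K n).map (expand p).toLinearMap := by
  rw [homogeneousSubmodule_fin_two_eq_span _ (1 + p * (n + 1)), Submodule.span_le]
  rintro _ ⟨a, b, hab, rfl⟩
  obtain ⟨i, c, hi, rfl⟩ : ∃ i c, i < p ∧ a = i + p * c :=
    ⟨a % p, a / p, Nat.mod_lt _ (by omega), (Nat.mod_add_div a p).symm⟩
  have hc : c ≤ n + 1 := by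
    have : c < n + 2 := by
      by_contra! h
      nlinarith [Nat.mul_le_mul_left p h]
    omega
  obtain hi1 | hi2 : i ≤ 1 ∨ 2 ≤ i := by omega
  · refine Submodule.mem_sup_left ?_
    rw [twistedProduct_one_eq_span]
    refine Submodule.subset_span ⟨(⟨i, by omega⟩, ⟨c, by omega⟩), ?_⟩
    simp only [← hab, Nat.add_sub_cancel_left]
  · refine Submodule.mem_sup_right ?_
    have hcn : c ≤ n := by
      by_contra! h
      nlinarith [Nat.mul_le_mul_left p h]
    obtain ⟨d, rfl⟩ := Nat.exists_eq_add_of_le hcn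
    obtain ⟨i, rfl⟩ := Nat.exists_eq_add_of_le' hi2
    obtain ⟨j, hj⟩ : ∃ j, i + j = c + d := ⟨c + d - i, by omega⟩
    have hb : b = j + 2 + p * d := by
      have : p * (c + d + 1) = p * c + p * d + p := by ring
      omega
    have h1 : (i : K) + 1 ≠ 0 := by
      exact_mod_cast cast_ne_zero_of_lt (K := K) (p := p) (a := i + 1) (by omega) (by omega)
    have h2 : (i : K) + 2 ≠ 0 := by
      exact_mod_cast cast_ne_zero_of_lt (K := K) (p := p) (a := i + 2) (by omega) (by omega)
    have h12 := mul_ne_zero h2 h1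
    have e : (X 0 ^ (i + 2 + p * c) * X 1 ^ b : MvPolynomial (Fin 2) K) =
        (((i : K) + 2) * ((i : K) + 1)) • (hessianLift K (X 0 ^ i * X 1 ^ j) *
          (expand p).toLinearMap (X 0 ^ c * X 1 ^ d)) := by
      rw [hessianLift_X_pow_mul_X_pow, ← smul_mul_assoc, smul_smul, mul_inv_cancel₀ h12, one_smul]
      simp only [hb, AlgHom.toLinearMap_apply, map_mul, map_pow, expand_X]
      ring
    rw [e]
    exact Submodule.smul_mem _ _ (Submodule.mul_mem_mul
      ⟨_, X_pow_mul_X_pow_mem_homogeneousSubmodule hj, rfl⟩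
      ⟨_, X_pow_mul_X_pow_mem_homogeneousSubmodule rfl, rfl⟩)

theorem finrank_map_toFunOn_homogeneousSubmodule [Fintype F] {d : ℕ} (hd : d < Fintype.card F) :
    Module.finrank K ((homogeneousSubmodule (Fin 2) K d).map (toFunOn ι).toLinearMap) = d + 1 := by
  have : (homogeneousSubmodule (Fin 2) K d).map (toFunOn ι).toLinearMap =
      Submodule.span K (Set.range fun i : Fin (d + 1) =>
        toFunOn ι (X 0 ^ (i : ℕ) * X 1 ^ (d - i))) := by
    rw [homogeneousSubmodule_fin_two_eq_span, Submodule.map_span]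
    congr 1
    ext f
    constructor
    · rintro ⟨_, ⟨a, b, rfl, rfl⟩, rfl⟩
      exact ⟨⟨a, by omega⟩, by simp⟩
    · rintro ⟨i, rfl⟩
      exact ⟨_, ⟨i, d - i, by omega, rfl⟩, rfl⟩
  rw [this, finrank_span_eq_card (linearIndependent_toFunOn ι hd), Fintype.card_fin]

theorem finrank_map_toFunOn_twistedProduct_one [Fintype F] {b : ℕ} (hp : 2 ≤ p)
    (hd : 1 + p * b < Fintype.card F) :
    Module.finrank K ((twistedProduct K p 1 b).map (toFunOn ι).toLinearMap) = 2 * (b + 1) := by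
  have hlt (x : Fin 2 × Fin (b + 1)) : (x.1 : ℕ) + p * x.2 < 1 + p * b + 1 := by
    have := Nat.mul_le_mul_left p (Nat.le_of_lt_succ x.2.2)
    omega
  have hinj : Function.Injective fun x : Fin 2 × Fin (b + 1) =>
      (⟨(x.1 : ℕ) + p * x.2, hlt x⟩ : Fin (1 + p * b + 1)) := by
    rintro ⟨i, c⟩ ⟨j, d⟩ h
    have h := Fin.val_eq_of_eq h
    dsimp only at h
    have hmod := congrArg (· % p) h
    have hi : (i : ℕ) < p := by omega
    have hj : (j : ℕ) < p := by omega
    simp only [Nat.add_mul_mod_self_left, Nat.mod_eq_of_lt hi, Nat.mod_eq_of_lt hj] at hmod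
    rw [hmod, Nat.add_left_cancel_iff, Nat.mul_left_cancel_iff (by omega)] at h
    rw [Fin.ext hmod, Fin.ext h]
  rw [twistedProduct_one_eq_span, Submodule.map_span, ← Set.range_comp]
  refine (finrank_span_eq_card ((linearIndependent_toFunOn ι hd).comp _ hinj)).trans ?_
  simp

theorem span_translates_eq_map_homogeneousSubmodule (d : ℕ) :
    Submodule.span K {h : (Fin 2 → F) → K |
      ∃ (g : Matrix.GeneralLinearGroup (Fin 2) F) (i j : ℕ), i + j = d ∧
        h = fun v => ι (Matrix.vecMul v (g : Matrix (Fin 2) (Fin 2) F) 0) ^ i *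
          ι (Matrix.vecMul v (g : Matrix (Fin 2) (Fin 2) F) 1) ^ j} =
      (homogeneousSubmodule (Fin 2) K d).map (toFunOn ι).toLinearMap := by
  apply le_antisymm
  · rw [Submodule.span_le]
    rintro _ ⟨g, i, j, hij, rfl⟩
    refine ⟨_, IsHomogeneous.bind₁_linear (X_pow_mul_X_pow_mem_homogeneousSubmodule hij)
      ((g : Matrix (Fin 2) (Fin 2) F).map ι), ?_⟩
    ext v
    refine (toFunOn_bind₁_apply ι _ _ _).trans ?_
    simp [toFunOn_apply]
  · rw [homogeneousSubmodule_fin_two_eq_span, Submodule.map_span, Submodule.span_le]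
    rintro _ ⟨_, ⟨i, j, hij, rfl⟩, rfl⟩
    refine Submodule.subset_span ⟨1, i, j, hij, ?_⟩
    ext v
    simp [toFunOn_apply]

theorem span_products_eq_map_twistedProduct (p a b : ℕ) :
    Submodule.span K {h : (Fin 2 → F) → K |
      ∃ f g : MvPolynomial (Fin 2) K,
        f ∈ homogeneousSubmodule (Fin 2) K a ∧ g ∈ homogeneousSubmodule (Fin 2) K b ∧
        h = fun v => eval (fun i => ι (v i)) f * eval (fun i => ι (v i) ^ p) g} =
      (twistedProduct K p a b).map (toFunOn ι).toLinearMap := by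
  rw [twistedProduct, Submodule.mul_eq_span_mul_set, Submodule.map_span]
  congr 1
  ext h
  constructor
  · rintro ⟨f, g, hf, hg, rfl⟩
    refine ⟨_, ⟨f, hf, _, ⟨g, hg, rfl⟩, rfl⟩, ?_⟩
    ext v
    simp [toFunOn_apply ι f, toFunOn_expand_apply]
  · rintro ⟨_, ⟨f, hf, _, ⟨g, hg, rfl⟩, rfl⟩, rfl⟩
    refine ⟨f, g, hf, hg, ?_⟩
    ext v
    simp [toFunOn_apply ι f, toFunOn_expand_apply]

/-- The bilinear map `(f, h) ↦ F * h(X₀ᵖ, X₁ᵖ)`, where `F` is the lift of `f`. -/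
noncomputable def liftMulExpand (K : Type*) [Field K] (p n : ℕ) :
    homogeneousSubmodule (Fin 2) K n ⊗[K] homogeneousSubmodule (Fin 2) K n →ₗ[K]
      MvPolynomial (Fin 2) K :=
  TensorProduct.lift ((LinearMap.mul K (MvPolynomial (Fin 2) K)).compl₁₂
    (hessianLift K ∘ₗ (homogeneousSubmodule (Fin 2) K n).subtype)
    ((expand p).toLinearMap ∘ₗ (homogeneousSubmodule (Fin 2) K n).subtype))

theorem liftMulExpand_tmul (p n : ℕ) (f h : homogeneousSubmodule (Fin 2) K n) :
    liftMulExpand K p n (f ⊗ₜ h) = hessianLift K f * expand p (h : MvPolynomial (Fin 2) K) := by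
  simp [liftMulExpand]

theorem liftMulExpand_mem {n : ℕ} (hn : n + 3 = p)
    (t : homogeneousSubmodule (Fin 2) K n ⊗[K] homogeneousSubmodule (Fin 2) K n) :
    liftMulExpand K p n t ∈ homogeneousSubmodule (Fin 2) K (1 + p * (n + 1)) := by
  induction t using TensorProduct.induction_on with
  | zero => simp
  | tmul f h =>
    rw [liftMulExpand_tmul, mem_homogeneousSubmodule]
    convert (isHomogeneous_hessianLift f.2).mul (IsHomogeneous.expand h.2 p) using 1
    rw [← hn]
    ring
  | add x y hx hy =>
    rw [map_add]
    exact Submodule.add_mem _ hx hy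

theorem map_mul_map_expand_le_range_liftMulExpand (p n : ℕ) :
    (homogeneousSubmodule (Fin 2) K n).map (hessianLift K) *
      (homogeneousSubmodule (Fin 2) K n).map (expand p).toLinearMap ≤
        LinearMap.range (liftMulExpand K p n) := by
  rw [Submodule.mul_le]
  rintro _ ⟨f, hf, rfl⟩ _ ⟨h, hh, rfl⟩
  exact ⟨⟨f, hf⟩ ⊗ₜ ⟨h, hh⟩, liftMulExpand_tmul p n _ _⟩

theorem hessianLift_bind₁_sub_mul_expand_mem [Fact p.Prime] [CharP K p] {n : ℕ} (hn : n + 3 = p)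
    (g : Matrix (Fin 2) (Fin 2) K) {f h : MvPolynomial (Fin 2) K} (hf : f.IsHomogeneous n)
    (hh : h.IsHomogeneous n) :
    (hessianLift K (g.det ^ 2 • bind₁ (fun i => ∑ j, C (g j i) * X j) f) -
      bind₁ (fun i => ∑ j, C (g j i) * X j) (hessianLift K f)) * expand p h ∈
        twistedProduct K p 1 (n + 1) := by
  have hf' : (g.det ^ 2 • bind₁ (fun i => ∑ j, C (g j i) * X j) f).IsHomogeneous n :=
    Submodule.smul_mem (homogeneousSubmodule (Fin 2) K n) _ (hf.bind₁_linear g)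
  refine mul_expand_mem_twistedProduct_of_mem_span (mem_span_of_pderiv_pderiv_eq_zero hn
    ((isHomogeneous_hessianLift hf').sub ((isHomogeneous_hessianLift hf).bind₁_linear g)) ?_) hh
  rw [map_sub, map_sub, (pderiv_pderiv_hessianLift hn hf').1,
    pderiv_pderiv_bind₁_hessianLift hn hf, sub_self]

end PolynomialFunctions

end MvPolynomial

open MvPolynomial

/-- Let `p > 5`, `k` algebraically closed of characteristic `p`,
`G̃ = GL₂(F_{p²})`.  Let `M₀ ⊆ U_{(p-1)²}` be the `G̃`-submodule generated by the homogeneous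
monomials of degree `(p-1)²` (realized as functions on `F_{p²}²`), and let `PsiIm` be the
image of `V_{1,p-2} = Sym¹(k²) ⊗ (Sym^{p-2}(k²))^τ` under `Ψ(f ⊗ g) = f(X,Y)g(X^p,Y^p)`.
Then `dim M₀ = (p-1)² + 1`, `dim PsiIm = 2(p-1)`, `PsiIm ≤ M₀`,
`(p-1)² + 1 = (p-2)² + 2(p-1)`, and `M₀/PsiIm ≅ Sym^{p-3}(k²) ⊗ det² ⊗ (Sym^{p-3}(k²))^τ`
as `G̃`-modules. -/
theorem stmt_9 (p : ℕ) [Fact p.Prime] (hp5 : 5 < p)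
    (F k : Type*) [Field F] [Fintype F] [CharP F p] [Field k] [IsAlgClosed k] [CharP k p]
    (hcard : Fintype.card F = p ^ 2) (ι : F →+* k)
    (M₀ PsiIm : Submodule k ((Fin 2 → F) → k))
    (hM₀ : M₀ = Submodule.span k {h : (Fin 2 → F) → k |
      ∃ (g : Matrix.GeneralLinearGroup (Fin 2) F) (i j : ℕ), i + j = (p - 1) ^ 2 ∧
        h = fun v => ι (Matrix.vecMul v (g : Matrix (Fin 2) (Fin 2) F) 0) ^ i *
          ι (Matrix.vecMul v (g : Matrix (Fin 2) (Fin 2) F) 1) ^ j})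
    (hPsiIm : PsiIm = Submodule.span k {h : (Fin 2 → F) → k |
      ∃ f g : MvPolynomial (Fin 2) k,
        f ∈ MvPolynomial.homogeneousSubmodule (Fin 2) k 1 ∧
        g ∈ MvPolynomial.homogeneousSubmodule (Fin 2) k (p - 2) ∧
        h = fun v => MvPolynomial.eval (fun i => ι (v i)) f *
          MvPolynomial.eval (fun i => ι (v i) ^ p) g}) :
    Module.finrank k M₀ = (p - 1) ^ 2 + 1 ∧
    Module.finrank k PsiIm = 2 * (p - 1) ∧
    PsiIm ≤ M₀ ∧
    (p - 1) ^ 2 + 1 = (p - 2) ^ 2 + 2 * (p - 1) ∧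
    ∃ e : (M₀ ⧸ (PsiIm.comap M₀.subtype)) ≃ₗ[k]
        (↥(MvPolynomial.homogeneousSubmodule (Fin 2) k (p - 3)) ⊗[k]
         ↥(MvPolynomial.homogeneousSubmodule (Fin 2) k (p - 3))),
      ∀ (g : Matrix.GeneralLinearGroup (Fin 2) F)
        (f h f' h' : ↥(MvPolynomial.homogeneousSubmodule (Fin 2) k (p - 3))),
        ((f' : MvPolynomial (Fin 2) k) =
          ι ((g : Matrix (Fin 2) (Fin 2) F).det) ^ 2 •
            MvPolynomial.bind₁ (fun i => ∑ j,
              MvPolynomial.C (ι ((g : Matrix (Fin 2) (Fin 2) F) j i)) * MvPolynomial.X j)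
              (f : MvPolynomial (Fin 2) k)) →
        ((h' : MvPolynomial (Fin 2) k) =
          MvPolynomial.bind₁ (fun i => ∑ j,
            MvPolynomial.C (ι ((g : Matrix (Fin 2) (Fin 2) F) j i) ^ p) * MvPolynomial.X j)
            (h : MvPolynomial (Fin 2) k)) →
        ∀ x y : M₀,
          e (Submodule.Quotient.mk x) = f' ⊗ₜ[k] h' →
          e (Submodule.Quotient.mk y) = f ⊗ₜ[k] h →
          ((x : (Fin 2 → F) → k) -
            fun v => (y : (Fin 2 → F) → k) (Matrix.vecMul v (g : Matrix (Fin 2) (Fin 2) F)))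
            ∈ PsiIm := by
  rw [span_translates_eq_map_homogeneousSubmodule] at hM₀
  have h2 : p - 2 = p - 3 + 1 := by omega
  have h1 : (p - 1) ^ 2 = 1 + p * (p - 3 + 1) := by
    obtain ⟨n, rfl⟩ := Nat.exists_eq_add_of_le' (show 3 ≤ p by omega)
    simp only [Nat.add_sub_cancel, show n + 3 - 1 = n + 2 by omega]
    ring
  have h1' : p - 1 = p - 3 + 1 + 1 := by omega
  have hn : p - 3 + 3 = p := by omega
  rw [span_products_eq_map_twistedProduct, h2] at hPsiIm
  rw [h1] at hM₀ ⊢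
  rw [h2, h1']
  generalize p - 3 = n at *
  have hlt : 1 + p * (n + 1) < Fintype.card F := by
    rw [hcard, ← hn]
    nlinarith
  have hrankM : Module.finrank k M₀ = 1 + p * (n + 1) + 1 := by
    rw [hM₀, finrank_map_toFunOn_homogeneousSubmodule ι hlt]
  have hrankP : Module.finrank k PsiIm = 2 * (n + 1 + 1) := by
    rw [hPsiIm, finrank_map_toFunOn_twistedProduct_one ι (by omega) hlt]
  have hle : PsiIm ≤ M₀ := by
    rw [hPsiIm, hM₀]
    exact Submodule.map_mono (twistedProduct_le p 1 (n + 1))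
  have hdim : 1 + p * (n + 1) + 1 = (n + 1) ^ 2 + 2 * (n + 1 + 1) := by
    rw [← hn]
    ring
  refine ⟨hrankM, hrankP, hle, hdim, ?_⟩
  have hmem (t) : ((toFunOn ι).toLinearMap ∘ₗ liftMulExpand k p n) t ∈ M₀ := by
    rw [hM₀]
    exact ⟨_, liftMulExpand_mem hn t, rfl⟩
  set L := (PsiIm.comap M₀.subtype).mkQ ∘ₗ LinearMap.codRestrict M₀ _ hmem with hL
  have hsurj : Function.Surjective L := by
    intro q
    obtain ⟨⟨x, hx⟩, rfl⟩ := Submodule.Quotient.mk_surjective _ q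
    have hx' := hx
    rw [hM₀] at hx'
    obtain ⟨u, hu, rfl⟩ := hx'
    obtain ⟨u₁, hu₁, u₂, hu₂, rfl⟩ := Submodule.mem_sup.mp (homogeneousSubmodule_le_sup hn hu)
    obtain ⟨t, rfl⟩ := map_mul_map_expand_le_range_liftMulExpand p n hu₂
    refine ⟨t, (Submodule.Quotient.eq _).mpr ?_⟩
    rw [Submodule.mem_comap, ← neg_mem_iff, hPsiIm]
    exact ⟨u₁, hu₁, by simp⟩
  have : Module.Finite k M₀ := Module.finite_of_finrank_pos (by omega)
  have hfin : Module.Finite k (homogeneousSubmodule (Fin 2) k n) :=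
    Module.Finite.iff_fg.mpr (homogeneousSubmodule_fg _ _ n)
  have hrankQ : Module.finrank k (M₀ ⧸ PsiIm.comap M₀.subtype) = (n + 1) ^ 2 := by
    have := (PsiIm.comap M₀.subtype).finrank_quotient_add_finrank
    rw [(Submodule.comapSubtypeEquivOfLe hle).finrank_eq, hrankM, hrankP] at this
    omega
  have hrank : Module.finrank k
      (homogeneousSubmodule (Fin 2) k n ⊗[k] homogeneousSubmodule (Fin 2) k n) =
        Module.finrank k (M₀ ⧸ PsiIm.comap M₀.subtype) := by
    refine le_antisymm ?_ (LinearMap.finrank_le_finrank_of_surjective hsurj)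
    rw [Module.finrank_tensorProduct, hrankQ, sq]
    have := finrank_homogeneousSubmodule_fin_two_le k n
    exact Nat.mul_le_mul this this
  have hinj : Function.Injective L := by
    exact OrzechProperty.injective_of_surjective_of_injective
      (LinearEquiv.ofFinrankEq _ _ hrank).toLinearMap L (LinearEquiv.injective _) hsurj
  refine ⟨(LinearEquiv.ofBijective L ⟨hinj, hsurj⟩).symm, ?_⟩
  intro g f h f' h' hf' hh' x y hx hy
  have key (z : M₀) (a b : homogeneousSubmodule (Fin 2) k n)
      (hz : (LinearEquiv.ofBijective L ⟨hinj, hsurj⟩).symm (Submodule.Quotient.mk z) =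
        a ⊗ₜ[k] b) :
      ∃ w ∈ twistedProduct k p 1 (n + 1), (z : (Fin 2 → F) → k) =
        toFunOn ι (w + hessianLift k a * expand p (b : MvPolynomial (Fin 2) k)) := by
    rw [LinearEquiv.symm_apply_eq] at hz
    have := (Submodule.Quotient.eq _).mp hz
    rw [Submodule.mem_comap, hPsiIm] at this
    obtain ⟨w, hw, hwz⟩ := this
    refine ⟨w, hw, ?_⟩
    rw [map_add, ← liftMulExpand_tmul]
    exact (sub_eq_iff_eq_add.mp hwz.symm)
  obtain ⟨w, hw, hwx⟩ := key x f' h' hx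
  obtain ⟨w', hw', hwy⟩ := key y f h hy
  have : ExpChar k p := .prime Fact.out
  set G := (g : Matrix (Fin 2) (Fin 2) F).map ι with hG
  have hdet : G.det = ι (g : Matrix (Fin 2) (Fin 2) F).det := (RingHom.map_det ι _).symm
  have hy' : (fun v => (y : (Fin 2 → F) → k) (Matrix.vecMul v (g : Matrix (Fin 2) (Fin 2) F))) =
      toFunOn ι (bind₁ (fun i => ∑ j, C (G j i) * X j)
        (w' + hessianLift k f * expand p (h : MvPolynomial (Fin 2) k))) := by
    ext v
    rw [hwy]
    exact (toFunOn_bind₁_apply ι _ _ _).symm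
  have hexp : bind₁ (fun i => ∑ j, C (G j i) * X j) (expand p (h : MvPolynomial (Fin 2) k)) =
      expand p (h' : MvPolynomial (Fin 2) k) := by
    rw [bind₁_linear_expand, hh']
    rfl
  rw [hy', hwx, ← map_sub, map_add, map_mul, hexp, add_sub_add_comm, ← sub_mul, hPsiIm, hf',
    ← hdet]
  exact ⟨_, Submodule.add_mem _ (Submodule.sub_mem _ hw (bind₁_linear_mem_twistedProduct hw' G))
    (hessianLift_bind₁_sub_mul_expand_mem hn G f.2 h'.2), rfl⟩
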